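/- arXiv:0902.1809 — 5 statements merged into one kernel-verified Lean document; each statement's English description precedes it below -/
import Mathlib

section
/- Let n be a natural number, M : Fin n → Fin n → Bool an adjacency matrix and V : Fin n → Bool a node vector. Then the compatibility condition of Matrix Graph Grammars holds, i.e. the Boolean vector (M ⊔ Mᵀ) ⊙ ¬V is identically false (equivalently, its 1-norm, the disjunction of all its components, is false), if and only if the digraph has no dangling edges, i.e. for all i j, M i j = true implies V i = true and V j = true. -/
theorem Bool.sup_inf_compl_eq_bot_iff (a b c : Bool) :
    (a ⊔ b) ⊓ cᶜ = ⊥ ↔ (a = true → c = true) ∧ (b = true → c = true) := by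
  revert a b c
  decide

/-- Compatibility of a simple digraph given by adjacency matrix `M` and node
vector `V`: the Boolean vector `(M ⊔ Mᵀ) ⊙ ¬V` is identically false (its
1-norm, the disjunction of all its components, is `false`) iff there are no
dangling edges. -/
theorem compatibility_iff_no_dangling (n : ℕ)
    (M : Fin n → Fin n → Bool) (V : Fin n → Bool) :
    (Finset.univ.sup
        (fun i : Fin n =>
          Finset.univ.sup (fun k : Fin n => (M i k ⊔ M k i) ⊓ (V k)ᶜ)) = false)
      ↔ (∀ i j : Fin n, M i j = true → V i = true ∧ V j = true) := by
  rw [show false = (⊥ : Bool) from rfl]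
  simp only [Finset.sup_eq_bot_iff, Finset.mem_univ, true_imp_iff,
    Bool.sup_inf_compl_eq_bot_iff]
  exact ⟨fun h i j hij => ⟨(h j i).2 hij, (h i j).1 hij⟩,
    fun h i k => ⟨fun hik => (h i k hik).2, fun hki => (h k i hki).1⟩⟩
end

section
/- In any Boolean algebra, let e, r, L be elements with e ≤ L and r ⊓ L = ⊥. Then the inverse production undoes the production on the left-hand side: e ⊔ (rᶜ ⊓ (r ⊔ (eᶜ ⊓ L))) = L, i.e. p⁻¹(p(L)) = L. -/
/-- If `e ≤ L` and `r ⊓ L = ⊥`, the inverse production undoes the production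
on the left-hand side: `p⁻¹(p(L)) = L`. -/
theorem inverse_production_undoes_production {α : Type*} [BooleanAlgebra α]
    (e r L : α) (he : e ≤ L) (hr : r ⊓ L = ⊥) :
    e ⊔ (rᶜ ⊓ (r ⊔ (eᶜ ⊓ L))) = L := by
  have hL : L ≤ rᶜ := (disjoint_iff.mpr hr).symm.le_compl_right
  rw [inf_sup_left, compl_inf_self, bot_sup_eq, inf_eq_right.mpr (inf_le_right.trans hL),
    sup_inf_left, sup_compl_eq_top, top_inf_eq, sup_eq_right.mpr he]
end

section
/- In any Boolean algebra, let e, r, R be elements with r ≤ R and e ⊓ R = ⊥. Then the production undoes the inverse production on the right-hand side: r ⊔ (eᶜ ⊓ (e ⊔ (rᶜ ⊓ R))) = R, i.e. p(p⁻¹(R)) = R. -/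
/-- If `r ≤ R` and `e ⊓ R = ⊥`, the production undoes the inverse production
on the right-hand side: `p(p⁻¹(R)) = R`. -/
theorem production_undoes_inverse_production {α : Type*} [BooleanAlgebra α]
    (e r R : α) (hr : r ≤ R) (he : e ⊓ R = ⊥) :
    r ⊔ (eᶜ ⊓ (e ⊔ (rᶜ ⊓ R))) = R := by
  have hR : R ≤ eᶜ := (disjoint_iff.2 he).symm.le_compl_right
  rw [inf_sup_left, compl_inf_self, bot_sup_eq, inf_eq_right.2 (inf_le_right.trans hR),
    sup_inf_left, sup_compl_eq_top, top_inf_eq, sup_eq_right.2 hr]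
end

section
/- In any Boolean algebra, let e, r, D be elements, let N := r ⊔ (eᶜ ⊓ Dᶜ) be the nihilation element, and assume the compatibility condition rᶜ ⊓ Dᶜ = Dᶜ. Then the image of N under the inverse production satisfies p⁻¹(N) = e ⊔ (rᶜ ⊓ N) = e ⊔ Dᶜ; that is, after applying the production, the forbidden elements are exactly the deleted elements together with the potential dangling edges. -/
/-- Evolution of the nihilation element: with `N := r ⊔ (eᶜ ⊓ Dᶜ)` and the
compatibility condition `rᶜ ⊓ Dᶜ = Dᶜ`, one has `p⁻¹(N) = e ⊔ Dᶜ`. -/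
theorem nihilation_evolution {α : Type*} [BooleanAlgebra α]
    (e r D : α) (hcompat : rᶜ ⊓ Dᶜ = Dᶜ) :
    e ⊔ (rᶜ ⊓ (r ⊔ (eᶜ ⊓ Dᶜ))) = e ⊔ Dᶜ := by
  rw [inf_sup_left, compl_inf_self, bot_sup_eq, inf_left_comm, hcompat, sup_inf_left,
    sup_compl_eq_top, top_inf_eq]
end

section
/- Let n be a natural number, G, L, N, A : Fin n → Fin n → Bool (all completed with respect to a fixed match), and for each pair (a,b) with A a b = true let A^{ab} denote the single-edge matrix which is true exactly at (a,b). Then the production p with application condition ∃A[Ā] is applicable to G — i.e. L ≤ G, N ⊓ G = ⊥, and there exists an edge (a,b) of A with G a b = false — if and only if some production in the set {p with nihilation matrix enlarged to N ⊔ A^{ab} : A a b = true} is applicable to G, i.e. there exist a, b with A a b = true, L ≤ G and (N ⊔ A^{ab}) ⊓ G = ⊥. -/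
/-- The single-edge Boolean matrix which is true exactly at `(a, b)`. -/
def singleEdge {n : ℕ} (a b : Fin n) : Fin n → Fin n → Bool :=
  fun i j => decide (i = a ∧ j = b)

theorem singleEdge_inf_eq_bot_iff {n : ℕ} (a b : Fin n) (G : Fin n → Fin n → Bool) :
    singleEdge a b ⊓ G = ⊥ ↔ G a b = false := by
  constructor
  · intro h
    simpa [singleEdge] using congrFun (congrFun h a) b
  · intro h
    funext i j
    by_cases hij : i = a ∧ j = b
    · obtain ⟨rfl, rfl⟩ := hij
      simp [h]
    · simp [singleEdge, hij]

/-- Decomposition: a production with application condition `∃A[Ā]` is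
applicable to `G` iff some production with nihilation matrix enlarged by a
single edge of `A` is applicable to `G`. -/
theorem applicable_with_decomposition_AC_iff (n : ℕ)
    (G L N A : Fin n → Fin n → Bool) :
    (L ≤ G ∧ N ⊓ G = ⊥ ∧ ∃ a b : Fin n, A a b = true ∧ G a b = false) ↔
      (∃ a b : Fin n, A a b = true ∧ L ≤ G ∧ (N ⊔ singleEdge a b) ⊓ G = ⊥) := by
  simp only [inf_sup_right, sup_eq_bot_iff, singleEdge_inf_eq_bot_iff]
  tauto
end
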